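/- Let n ≥ 2 be an integer and let x be a complex number which is not an integer. Define U_n(x) = 2[(n+n²)(n+n²−x) + (1−n−n²)x² + x³ − x⁴]/((n+n²)(n+n²−x)x), V_n(x) = 2[n³(1+n)(1+n+x) − n²(2+n)x² − (1−2n−n²)x³ − (1+n)x⁴ + x⁵]/((n+n²)(n+n²−x)(n−x)x), and W_n(x) = 2[2n²(1+n)² − n²(5+3n)x − 2(1−3n−2n²)x² − 3(1+n)x³ + 2x⁴]/((1+n)(n+n²−x)(n−x)²x). Then Σ_{k=0}^{n} (−1)^k C(n,k) · C(n+k,k)/C(x+k,k) · k² · H_k(x)² = (−1)^n · ((n+n²)(n+n²−x)/(2(1−x)(2−x))) · (C(−x+n,n)/C(x+n,n)) · { H_n^{⟨2⟩}(x) − H_n^{⟨2⟩}(−x) + 2[H_n(x) + H_{n−2}(2−x) + 2/(n+n²−x)] · [H_n(x) + H_{n−2}(2−x)] − [H_n(x) − H_n(−x) − 2H_{n+1}((x−n−2)/2) + U_n(x)] · [H_n(x) − H_n(−x)] − H_n((x−n)/2) · [H_n((x−n)/2) − V_n(x)] + 2(2x² − 6x + 5)/((1−x)²(2−x)²) − W_n(x)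 }. -/

import Mathlib

open Finset

/-- Generalized harmonic number `H_n(x) = ∑_{k=1}^n 1/(x+k)`. -/
noncomputable def genH (n : ℕ) (x : ℂ) : ℂ := ∑ k ∈ Finset.range n, 1 / (x + (k + 1))

/-- Generalized second-order harmonic number `H_n^{⟨2⟩}(x) = ∑_{k=1}^n 1/(x+k)^2`. -/
noncomputable def genH2 (n : ℕ) (x : ℂ) : ℂ := ∑ k ∈ Finset.range n, 1 / (x + (k + 1)) ^ 2

/-- Generalized binomial coefficient `C(z,m) = (∏_{j=0}^{m-1} (z-j))/m!`. -/
noncomputable def cbinom (z : ℂ) (m : ℕ) : ℂ := (∏ j ∈ Finset.range m, (z - j)) / (m.factorial : ℂ)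

/-- `U_n(x)` from Theorem 2.3 of the paper. -/
noncomputable def Ufun (n : ℕ) (x : ℂ) : ℂ :=
  2 * (((n : ℂ) + (n : ℂ) ^ 2) * ((n : ℂ) + (n : ℂ) ^ 2 - x) + (1 - (n : ℂ) - (n : ℂ) ^ 2) * x ^ 2
        + x ^ 3 - x ^ 4)
    / (((n : ℂ) + (n : ℂ) ^ 2) * ((n : ℂ) + (n : ℂ) ^ 2 - x) * x)

/-- `V_n(x)` from Theorem 2.3 of the paper. -/
noncomputable def Vfun (n : ℕ) (x : ℂ) : ℂ :=
  2 * ((n : ℂ) ^ 3 * (1 + (n : ℂ)) * (1 + (n : ℂ) + x) - (n : ℂ) ^ 2 * (2 + (n : ℂ)) * x ^ 2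
        - (1 - 2 * (n : ℂ) - (n : ℂ) ^ 2) * x ^ 3 - (1 + (n : ℂ)) * x ^ 4 + x ^ 5)
    / (((n : ℂ) + (n : ℂ) ^ 2) * ((n : ℂ) + (n : ℂ) ^ 2 - x) * ((n : ℂ) - x) * x)

/-- `W_n(x)` from Theorem 2.3 of the paper. -/
noncomputable def Wfun (n : ℕ) (x : ℂ) : ℂ :=
  2 * (2 * (n : ℂ) ^ 2 * (1 + (n : ℂ)) ^ 2 - (n : ℂ) ^ 2 * (5 + 3 * (n : ℂ)) * x
        - 2 * (1 - 3 * (n : ℂ) - 2 * (n : ℂ) ^ 2) * x ^ 2 - 3 * (1 + (n : ℂ)) * x ^ 3 + 2 * x ^ 4)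
    / ((1 + (n : ℂ)) * ((n : ℂ) + (n : ℂ) ^ 2 - x) * ((n : ℂ) - x) ^ 2 * x)

/-- The summand `(-1)^k C(n,k) C(n+k,k) / C(x+k,k)`. -/
noncomputable def legTerm (x : ℂ) (n k : ℕ) : ℂ :=
  (-1 : ℂ) ^ k * (n.choose k : ℂ) * (((n + k).choose k : ℂ) / cbinom (x + k) k)

/-- The common part of `legTerm x n k` and `legTerm x (n + 1) k`, equal to
`legTerm x n k / (n + 1 - k)` away from `k = n + 1`. -/
noncomputable def legCore (x : ℂ) (n k : ℕ) : ℂ :=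
  (-1 : ℂ) ^ k * ((n + 1).choose k : ℂ) * (((n + k).choose k : ℂ) / cbinom (x + k) k) / (n + 1)

/-- The alternating sum `∑_{|j| ≤ n} (-1)^(n-j) / (x+j)`. -/
noncomputable def altSum (x : ℂ) : ℕ → ℂ
  | 0 => 1 / x
  | n + 1 => 1 / (x + (n + 1)) - 1 / ((n + 1) - x) - altSum x n

/-- The closed form `(-1)^n C(n-x,n) / C(n+x,n)` of `∑ k, legTerm x n k`. -/
noncomputable def legSum (x : ℂ) (n : ℕ) : ℂ :=
  (-1 : ℂ) ^ n * (cbinom (-x + n) n / cbinom (x + n) n)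

theorem cbinom_add_succ (x : ℂ) (k : ℕ) :
    cbinom (x + (k + 1 : ℕ)) (k + 1) = cbinom (x + k) k * (x + (k + 1)) / (k + 1) := by
  have hk : (k : ℂ) + 1 ≠ 0 := by exact_mod_cast k.succ_ne_zero
  have hf : (k.factorial : ℂ) ≠ 0 := by exact_mod_cast k.factorial_ne_zero
  unfold cbinom
  rw [Finset.prod_range_succ', Nat.factorial_succ]
  have : ∀ j : ℕ, x + (k + 1 : ℕ) - (j + 1 : ℕ) = x + k - j := by intro j; push_cast; ring
  simp only [this]
  push_cast
  field_simp
  ring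

theorem legCore_mul_sub (x : ℂ) {n k : ℕ} (hk : k ≤ n + 1) :
    legTerm x n k = (n + 1 - k) * legCore x n k := by
  have hn : (n : ℂ) + 1 ≠ 0 := by exact_mod_cast n.succ_ne_zero
  have h := congrArg (Nat.cast (R := ℂ)) (Nat.choose_mul_succ_eq n k)
  push_cast [Nat.cast_sub hk] at h
  unfold legTerm legCore
  field_simp
  linear_combination ((n + k).choose k : ℂ) / cbinom (x + k) k * h

theorem legCore_mul_add (x : ℂ) (n k : ℕ) :
    legTerm x (n + 1) k = (n + 1 + k) * legCore x n k := by
  have hn : (n : ℂ) + 1 ≠ 0 := by exact_mod_cast n.succ_ne_zero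
  have h := congrArg (Nat.cast (R := ℂ)) (Nat.choose_mul_succ_eq (n + k) k)
  rw [show n + k + 1 - k = n + 1 by omega] at h
  push_cast at h
  unfold legTerm legCore
  rw [show n + 1 + k = n + k + 1 by omega]
  field_simp
  linear_combination -((n + 1).choose k : ℂ) / cbinom (x + k) k * h

theorem add_natCast_ne_zero {x : ℂ} (hx : ∀ m : ℤ, x ≠ (m : ℂ)) (k : ℕ) : x + k ≠ 0 := fun h =>
  hx (-k) (by push_cast; linear_combination h)

theorem natCast_sub_ne_zero {x : ℂ} (hx : ∀ m : ℤ, x ≠ (m : ℂ)) (k : ℕ) : (k : ℂ) - x ≠ 0 := fun h =>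
  hx k (by push_cast; linear_combination -h)

theorem cbinom_add_ne_zero {x : ℂ} (hx : ∀ m : ℤ, x ≠ (m : ℂ)) (k : ℕ) : cbinom (x + k) k ≠ 0 := by
  refine div_ne_zero (Finset.prod_ne_zero_iff.2 fun j hj h => hx (j - k) ?_)
    (by exact_mod_cast k.factorial_ne_zero)
  push_cast
  linear_combination h

theorem legTerm_succ_right {x : ℂ} (hx : ∀ m : ℤ, x ≠ (m : ℂ)) {n k : ℕ} (hk : k ≤ n) :
    (k + 1) * (x + (k + 1)) * legTerm x n (k + 1) = (k - n) * (n + 1 + k) * legTerm x n k := by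
  have h0 := cbinom_add_ne_zero hx k
  have h1 : x + (k + 1) ≠ 0 := by exact_mod_cast add_natCast_ne_zero hx (k + 1)
  have hk1 : (k : ℂ) + 1 ≠ 0 := by exact_mod_cast k.succ_ne_zero
  have e1 := congrArg (Nat.cast (R := ℂ)) (Nat.choose_succ_right_eq n k)
  have e2 := congrArg (Nat.cast (R := ℂ)) (Nat.add_one_mul_choose_eq (n + k) k)
  push_cast [Nat.cast_sub hk] at e1 e2
  unfold legTerm
  rw [cbinom_add_succ, ← add_assoc n k 1, pow_succ]
  field_simp
  linear_combination -((k + 1) * ((n + k + 1).choose (k + 1) : ℂ)) * e1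
    + ((n.choose k : ℂ) * (n - k)) * e2

theorem legCore_succ_right {x : ℂ} (hx : ∀ m : ℤ, x ≠ (m : ℂ)) {n k : ℕ} (hk : k ≤ n + 1) :
    (k + 1) * (x + (k + 1)) * legCore x n (k + 1)
      = -((n + 1 - k) * (n + 1 + k) * legCore x n k) := by
  have h0 := cbinom_add_ne_zero hx k
  have h1 : x + (k + 1) ≠ 0 := by exact_mod_cast add_natCast_ne_zero hx (k + 1)
  have hn : (n : ℂ) + 1 ≠ 0 := by exact_mod_cast n.succ_ne_zero
  have hk1 : (k : ℂ) + 1 ≠ 0 := by exact_mod_cast k.succ_ne_zero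
  have e1 := congrArg (Nat.cast (R := ℂ)) (Nat.choose_succ_right_eq (n + 1) k)
  have e2 := congrArg (Nat.cast (R := ℂ)) (Nat.add_one_mul_choose_eq (n + k) k)
  push_cast [Nat.cast_sub hk] at e1 e2
  unfold legCore
  rw [cbinom_add_succ, ← add_assoc n k 1, pow_succ]
  field_simp
  linear_combination -((k + 1) * ((n + k + 1).choose (k + 1) : ℂ)) * e1
    + (((n + 1).choose k : ℂ) * (n + 1 - k)) * e2

theorem legTerm_eq_zero (x : ℂ) {n k : ℕ} (hk : n < k) : legTerm x n k = 0 := by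
  simp [legTerm, Nat.choose_eq_zero_of_lt hk]

theorem legCore_eq_zero (x : ℂ) {n k : ℕ} (hk : n + 1 < k) : legCore x n k = 0 := by
  simp [legCore, Nat.choose_eq_zero_of_lt hk]

theorem genH_succ (n : ℕ) (x : ℂ) : genH (n + 1) x = genH n x + 1 / (x + (n + 1)) :=
  Finset.sum_range_succ _ _

theorem genH2_succ (n : ℕ) (x : ℂ) : genH2 (n + 1) x = genH2 n x + 1 / (x + (n + 1)) ^ 2 :=
  Finset.sum_range_succ _ _

theorem sum_legTerm_mul_succ (x : ℂ) (n : ℕ) (w : ℕ → ℂ) :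
    ∑ k ∈ range (n + 1), legTerm x n k * w k = ∑ k ∈ range (n + 2), legTerm x n k * w k := by
  rw [Finset.sum_range_succ _ (n + 1), legTerm_eq_zero x (Nat.lt_succ_self n)]
  simp

/-- Telescoping in `k` for the recurrence in `n`. The weight `v` plays the role of the shift
`v (k + 1) = u k`. -/
theorem sum_legTerm_recurrence {x : ℂ} (hx : ∀ m : ℤ, x ≠ (m : ℂ)) (n : ℕ) (u v : ℕ → ℂ)
    (huv : ∀ k, v (k + 1) = u k) :
    ∑ k ∈ range (n + 2), (((n + 1 + x) * legTerm x (n + 1) k + (n + 1 - x) * legTerm x n k) * u k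
      - (legTerm x (n + 1) k - legTerm x n k) * ((x + k) * (u k - v k))) = 0 := by
  have hg : ∀ k ∈ range (n + 2),
      ((n + 1 + x) * legTerm x (n + 1) k + (n + 1 - x) * legTerm x n k) * u k
        - (legTerm x (n + 1) k - legTerm x n k) * ((x + k) * (u k - v k))
      = (-2 * ((k + 1 : ℕ) : ℂ) * (x + (k + 1 : ℕ)) * legCore x n (k + 1) * v (k + 1))
        - (-2 * (k : ℂ) * (x + k) * legCore x n k * v k) := by
    intro k hk
    have hk' : k ≤ n + 1 := by simpa [Nat.lt_succ_iff] using hk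
    have h := legCore_succ_right hx hk'
    rw [legCore_mul_add, legCore_mul_sub x hk', huv]
    push_cast
    linear_combination -(-2 * u k) * h
  rw [Finset.sum_congr rfl hg,
    Finset.sum_range_sub (fun k : ℕ => -2 * (k : ℂ) * (x + k) * legCore x n k * v k)]
  simp [legCore_eq_zero x (Nat.lt_succ_self (n + 1))]

/-- Telescoping in `k` for fixed `n`, with polynomial factor `p`. -/
theorem sum_legTerm_telescope {x : ℂ} (hx : ∀ m : ℤ, x ≠ (m : ℂ)) (n : ℕ) (p : ℂ → ℂ)
    (u v : ℕ → ℂ) (huv : ∀ k, v (k + 1) = u k) :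
    ∑ k ∈ range (n + 1), legTerm x n k * (((k - n) * (n + 1 + k) * p (k + 1) - k * (x + k) * p k)
      * u k + k * p k * ((x + k) * (u k - v k))) = 0 := by
  have hg : ∀ k ∈ range (n + 1),
      legTerm x n k * (((k - n) * (n + 1 + k) * p (k + 1) - k * (x + k) * p k)
        * u k + k * p k * ((x + k) * (u k - v k)))
      = (((k + 1 : ℕ) : ℂ) * p (k + 1 : ℕ) * (x + (k + 1 : ℕ)) * legTerm x n (k + 1) * v (k + 1))
        - ((k : ℂ) * p k * (x + k) * legTerm x n k * v k) := by
    intro k hk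
    have hk' : k ≤ n := by simpa [Nat.lt_succ_iff] using hk
    have h := legTerm_succ_right hx hk'
    rw [huv]
    push_cast
    linear_combination -(u k * p (k + 1)) * h
  rw [Finset.sum_congr rfl hg,
    Finset.sum_range_sub (fun k : ℕ => (k : ℂ) * p k * (x + k) * legTerm x n k * v k)]
  simp [legTerm_eq_zero x (Nat.lt_succ_self n)]

theorem legSum_succ {x : ℂ} (hx : ∀ m : ℤ, x ≠ (m : ℂ)) (n : ℕ) :
    (x + (n + 1)) * legSum x (n + 1) = -((n + 1 - x) * legSum x n) := by
  have h0 := cbinom_add_ne_zero hx n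
  have h1 : x + (n + 1) ≠ 0 := by exact_mod_cast add_natCast_ne_zero hx (n + 1)
  have hn : (n : ℂ) + 1 ≠ 0 := by exact_mod_cast n.succ_ne_zero
  unfold legSum
  rw [cbinom_add_succ, cbinom_add_succ, pow_succ]
  field_simp
  ring

theorem sum_legTerm {x : ℂ} (hx : ∀ m : ℤ, x ≠ (m : ℂ)) (n : ℕ) :
    ∑ k ∈ range (n + 1), legTerm x n k = legSum x n := by
  induction n with
  | zero => simp [legTerm, legSum, cbinom]
  | succ n ih =>
    have h1 : x + (n + 1) ≠ 0 := by exact_mod_cast add_natCast_ne_zero hx (n + 1)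
    have h := sum_legTerm_recurrence hx n (fun _ => 1) (fun _ => 1) (fun _ => rfl)
    have e := sum_legTerm_mul_succ x n (fun _ => 1)
    simp only [mul_one, sub_self, mul_zero, sub_zero, Finset.sum_add_distrib,
      ← Finset.mul_sum] at h e
    rw [← e, ih] at h
    apply mul_left_cancel₀ h1
    linear_combination h - legSum_succ hx n

theorem sum_legTerm_div {x : ℂ} (hx : ∀ m : ℤ, x ≠ (m : ℂ)) (n : ℕ) :
    ∑ k ∈ range (n + 1), legTerm x n k * (1 / (x + k)) = legSum x n * altSum x n := by
  induction n with
  | zero => simp [legTerm, legSum, cbinom, altSum]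
  | succ n ih =>
    have h1 : x + (n + 1) ≠ 0 := by exact_mod_cast add_natCast_ne_zero hx (n + 1)
    have h2 : (n : ℂ) + 1 - x ≠ 0 := by exact_mod_cast natCast_sub_ne_zero hx (n + 1)
    have hpt : ∀ k ∈ range (n + 2), (x + (n + 1)) * (legTerm x (n + 1) k * (1 / (x + k)))
        = (n + 1 - x) * (legTerm x n k * (1 / (x + k)))
          + (legTerm x (n + 1) k + legTerm x n k) := by
      intro k hk
      have hk' : k ≤ n + 1 := by simpa [Nat.lt_succ_iff] using hk
      have := add_natCast_ne_zero hx k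
      rw [legCore_mul_add, legCore_mul_sub x hk']
      field_simp
      ring
    have h := Finset.sum_congr rfl hpt
    have e := sum_legTerm_mul_succ x n (fun _ => 1)
    simp only [mul_one] at e
    rw [← Finset.mul_sum, Finset.sum_add_distrib, Finset.sum_add_distrib, ← Finset.mul_sum,
      ← sum_legTerm_mul_succ x n (fun k => 1 / (x + k)), ih, sum_legTerm hx (n + 1), ← e,
      sum_legTerm hx n] at h
    have hs : legSum x (n + 1) = -((n + 1 - x) * legSum x n) / (x + (n + 1)) := by
      rw [eq_div_iff h1]; linear_combination legSum_succ hx n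
    apply mul_left_cancel₀ h1
    rw [h, altSum, hs]
    field_simp
    ring

theorem genH_succ_sub (x : ℂ) (k : ℕ) : genH (k + 1) x - 1 / (x + (k + 1 : ℕ)) = genH k x := by
  rw [genH_succ]; push_cast; ring

theorem sum_legTerm_genH {x : ℂ} (hx : ∀ m : ℤ, x ≠ (m : ℂ)) (n : ℕ) :
    ∑ k ∈ range (n + 1), legTerm x n k * genH k x = legSum x n * (genH n x + genH n (-x)) := by
  induction n with
  | zero => simp [genH]
  | succ n ih =>
    have h1 : x + (n + 1) ≠ 0 := by exact_mod_cast add_natCast_ne_zero hx (n + 1)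
    have h2 : (n : ℂ) + 1 - x ≠ 0 := by exact_mod_cast natCast_sub_ne_zero hx (n + 1)
    have h := sum_legTerm_recurrence hx n (fun k => genH k x)
      (fun k => genH k x - 1 / (x + k)) (genH_succ_sub x)
    have hpt : ∀ k ∈ range (n + 2),
        ((n + 1 + x) * legTerm x (n + 1) k + (n + 1 - x) * legTerm x n k) * genH k x
          - (legTerm x (n + 1) k - legTerm x n k)
            * ((x + k) * (genH k x - (genH k x - 1 / (x + k))))
        = (n + 1 + x) * (legTerm x (n + 1) k * genH k x)
          + (n + 1 - x) * (legTerm x n k * genH k x)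
          - (legTerm x (n + 1) k - legTerm x n k) := by
      intro k _
      have := add_natCast_ne_zero hx k
      field_simp
      ring
    have e := sum_legTerm_mul_succ x n (fun _ => 1)
    simp only [mul_one] at e
    rw [Finset.sum_congr rfl hpt, Finset.sum_sub_distrib, Finset.sum_sub_distrib,
      Finset.sum_add_distrib, ← Finset.mul_sum, ← Finset.mul_sum,
      ← sum_legTerm_mul_succ x n (fun k => genH k x), ih, sum_legTerm hx (n + 1), ← e,
      sum_legTerm hx n] at h
    have hs : legSum x (n + 1) = -((n + 1 - x) * legSum x n) / (x + (n + 1)) := by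
      rw [eq_div_iff h1]; linear_combination legSum_succ hx n
    apply mul_left_cancel₀ h1
    rw [hs] at h ⊢
    rw [genH_succ, genH_succ, neg_add_eq_sub]
    rw [← sub_eq_zero] at h ⊢
    rw [← h]
    field_simp
    ring

theorem sum_legTerm_genH_sq {x : ℂ} (hx : ∀ m : ℤ, x ≠ (m : ℂ)) (n : ℕ) :
    ∑ k ∈ range (n + 1), legTerm x n k * genH k x ^ 2
      = legSum x n * ((genH n x + genH n (-x)) ^ 2 - altSum x n ^ 2 / 2
        + (genH2 n x - genH2 n (-x)) / 2 + 1 / (2 * x ^ 2)) := by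
  have hx0 : x ≠ 0 := by simpa using hx 0
  induction n with
  | zero => simp [genH, genH2, altSum]; ring_nf; tauto
  | succ n ih =>
    have h1 : x + (n + 1) ≠ 0 := by exact_mod_cast add_natCast_ne_zero hx (n + 1)
    have h2 : (n : ℂ) + 1 - x ≠ 0 := by exact_mod_cast natCast_sub_ne_zero hx (n + 1)
    have h := sum_legTerm_recurrence hx n (fun k => genH k x ^ 2)
      (fun k => (genH k x - 1 / (x + k)) ^ 2) (fun k => by rw [genH_succ_sub])
    have hpt : ∀ k ∈ range (n + 2),
        ((n + 1 + x) * legTerm x (n + 1) k + (n + 1 - x) * legTerm x n k) * genH k x ^ 2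
          - (legTerm x (n + 1) k - legTerm x n k)
            * ((x + k) * (genH k x ^ 2 - (genH k x - 1 / (x + k)) ^ 2))
        = (n + 1 + x) * (legTerm x (n + 1) k * genH k x ^ 2)
          + (n + 1 - x) * (legTerm x n k * genH k x ^ 2)
          - (2 * (legTerm x (n + 1) k * genH k x) - 2 * (legTerm x n k * genH k x))
          + (legTerm x (n + 1) k * (1 / (x + k)) - legTerm x n k * (1 / (x + k))) := by
      intro k _
      have := add_natCast_ne_zero hx k
      field_simp
      ring
    rw [Finset.sum_congr rfl hpt, Finset.sum_add_distrib, Finset.sum_sub_distrib,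
      Finset.sum_sub_distrib, Finset.sum_sub_distrib,
      Finset.sum_add_distrib, ← Finset.mul_sum, ← Finset.mul_sum, ← Finset.mul_sum,
      ← Finset.mul_sum,
      ← sum_legTerm_mul_succ x n (fun k => genH k x ^ 2), ih,
      ← sum_legTerm_mul_succ x n (fun k => genH k x), sum_legTerm_genH hx n,
      ← sum_legTerm_mul_succ x n (fun k => 1 / (x + k)), sum_legTerm_div hx n,
      sum_legTerm_genH hx (n + 1), sum_legTerm_div hx (n + 1)] at h
    have hs : legSum x (n + 1) = -((n + 1 - x) * legSum x n) / (x + (n + 1)) := by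
      rw [eq_div_iff h1]; linear_combination legSum_succ hx n
    apply mul_left_cancel₀ h1
    rw [hs] at h ⊢
    simp only [genH_succ, genH2_succ, altSum, neg_add_eq_sub] at h ⊢
    rw [← sub_eq_zero] at h ⊢
    rw [← h]
    field_simp
    ring

theorem genH_succ_left (n : ℕ) (x : ℂ) : genH (n + 1) x = 1 / (x + 1) + genH n (x + 1) := by
  unfold genH
  rw [Finset.sum_range_succ', add_comm]
  congr 1
  · simp
  · refine Finset.sum_congr rfl fun k _ => ?_
    push_cast
    ring

theorem genH_half_eq {x : ℂ} (hx : ∀ m : ℤ, x ≠ (m : ℂ)) (n : ℕ) :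
    genH n ((x - n) / 2) = altSum x n + (genH n x - genH n (-x)) + 1 / x + 2 / (n - x) := by
  have hx0 : x ≠ 0 := by simpa using hx 0
  induction n using Nat.twoStepInduction with
  | zero => simp [genH, altSum]; field_simp; ring
  | one =>
    have h1 : x + 1 ≠ 0 := by exact_mod_cast add_natCast_ne_zero hx 1
    have h2 : 1 - x ≠ 0 := by exact_mod_cast natCast_sub_ne_zero hx 1
    simp only [genH, altSum, Finset.sum_range_one, Nat.cast_zero, Nat.cast_one, zero_add,
      neg_add_eq_sub]
    rw [show (x - 1) / 2 + 1 = (x + 1) / 2 by ring]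
    field_simp
    ring
  | more n ih _ =>
    have h0 : (n : ℂ) - x ≠ 0 := natCast_sub_ne_zero hx n
    have h1 : x + (n + 1) ≠ 0 := by exact_mod_cast add_natCast_ne_zero hx (n + 1)
    have h2 : (n : ℂ) + 1 - x ≠ 0 := by exact_mod_cast natCast_sub_ne_zero hx (n + 1)
    have h3 : x + (n + 1 + 1) ≠ 0 := by exact_mod_cast add_natCast_ne_zero hx (n + 1 + 1)
    have h4 : (n : ℂ) + 1 + 1 - x ≠ 0 := by exact_mod_cast natCast_sub_ne_zero hx (n + 1 + 1)
    have hl : genH (n + 2) ((x - (n + 2 : ℕ)) / 2)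
        = genH n ((x - n) / 2) - 2 / (n - x) + 2 / (x + (n + 1 + 1)) := by
      rw [genH_succ, genH_succ_left]
      push_cast
      rw [show (x - (n + 2)) / 2 + 1 = (x - n) / 2 by ring,
        show (x - (n + 2)) / 2 + (n + 1 + 1) = (x + (n + 1 + 1)) / 2 by ring,
        show x - n = -(n - x) by ring]
      field_simp
      ring
    rw [hl, ih]
    simp only [altSum, genH_succ, neg_add_eq_sub]
    push_cast
    rw [show (n : ℂ) + 2 = n + 1 + 1 by ring]
    field_simp
    ring

theorem sum_legTerm_sq_mul_genH_sq {x : ℂ} (hx : ∀ m : ℤ, x ≠ (m : ℂ)) (n : ℕ) :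
    ∑ k ∈ range (n + 1), legTerm x n k * (k ^ 2 * genH k x ^ 2)
      = legSum x n / (2 - x) * (n * (n + 1) * (n * (n + 1) - x) / (1 - x)
            * ((genH n x + genH n (-x)) ^ 2 - altSum x n ^ 2 / 2
              + (genH2 n x - genH2 n (-x)) / 2 + 1 / (2 * x ^ 2))
          - 2 * (n * (n + 1) * (n * (n + 1) - 1) / (1 - x) ^ 2
              + n * (n + 1) * (n * (n + 1) - x) / ((1 - x) * (2 - x)))
            * (genH n x + genH n (-x))
          + x * (1 - n * (n + 1) + x - x ^ 2) / (1 - x) * altSum x n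
          + (n * (n + 1) - 1) / (1 - x) * (2 * (n * (n + 1)) / (1 - x) ^ 2 + 1)
          + 2 / (2 - x) * ((n * (n + 1) - 1) * (n * (n + 1)) / (1 - x) ^ 2
              + n * (n + 1) * (n * (n + 1) - x) / ((1 - x) * (2 - x)))
          + n * (n + 1) / (1 - x) - x) := by
  have h1 : 1 - x ≠ 0 := by exact_mod_cast natCast_sub_ne_zero hx 1
  have h2 : 2 - x ≠ 0 := by exact_mod_cast natCast_sub_ne_zero hx 2
  have t10 : (1 - x) * ∑ k ∈ range (n + 1), legTerm x n k * k
      = n * (n + 1) * ∑ k ∈ range (n + 1), legTerm x n k := by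
    rw [← sub_eq_zero, Finset.mul_sum, Finset.mul_sum, ← Finset.sum_sub_distrib,
      ← sum_legTerm_telescope hx n (fun _ => 1) (fun _ => 1) (fun _ => 1) (fun _ => rfl)]
    exact Finset.sum_congr rfl fun k _ => by ring
  have t20 : (2 - x) * ∑ k ∈ range (n + 1), legTerm x n k * k ^ 2
      = (n * (n + 1) - 1) * ∑ k ∈ range (n + 1), legTerm x n k * k
        + n * (n + 1) * ∑ k ∈ range (n + 1), legTerm x n k := by
    rw [← sub_eq_zero, Finset.mul_sum, Finset.mul_sum, Finset.mul_sum, ← Finset.sum_add_distrib,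
      ← Finset.sum_sub_distrib,
      ← sum_legTerm_telescope hx n (fun t => t) (fun _ => 1) (fun _ => 1) (fun _ => rfl)]
    exact Finset.sum_congr rfl fun k _ => by ring
  have t11 : (1 - x) * ∑ k ∈ range (n + 1), legTerm x n k * (k * genH k x)
      = n * (n + 1) * ∑ k ∈ range (n + 1), legTerm x n k * genH k x
        - ∑ k ∈ range (n + 1), legTerm x n k * k := by
    rw [← sub_eq_zero, Finset.mul_sum, Finset.mul_sum, ← Finset.sum_sub_distrib,
      ← Finset.sum_sub_distrib,
      ← sum_legTerm_telescope hx n (fun _ => 1) (fun k => genH k x)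
        (fun k => genH k x - 1 / (x + k)) (genH_succ_sub x)]
    refine Finset.sum_congr rfl fun k _ => ?_
    have := add_natCast_ne_zero hx k
    field_simp
    ring
  have t21 : (2 - x) * ∑ k ∈ range (n + 1), legTerm x n k * (k ^ 2 * genH k x)
      = (n * (n + 1) - 1) * ∑ k ∈ range (n + 1), legTerm x n k * (k * genH k x)
        + n * (n + 1) * ∑ k ∈ range (n + 1), legTerm x n k * genH k x
        - ∑ k ∈ range (n + 1), legTerm x n k * k ^ 2 := by
    rw [← sub_eq_zero, Finset.mul_sum, Finset.mul_sum, Finset.mul_sum, ← Finset.sum_add_distrib,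
      ← Finset.sum_sub_distrib, ← Finset.sum_sub_distrib,
      ← sum_legTerm_telescope hx n (fun t => t) (fun k => genH k x)
        (fun k => genH k x - 1 / (x + k)) (genH_succ_sub x)]
    refine Finset.sum_congr rfl fun k _ => ?_
    have := add_natCast_ne_zero hx k
    field_simp
    ring
  have t12 : (1 - x) * ∑ k ∈ range (n + 1), legTerm x n k * (k * genH k x ^ 2)
      = n * (n + 1) * ∑ k ∈ range (n + 1), legTerm x n k * genH k x ^ 2
        - 2 * ∑ k ∈ range (n + 1), legTerm x n k * (k * genH k x)
        + ∑ k ∈ range (n + 1), legTerm x n k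
        - x * ∑ k ∈ range (n + 1), legTerm x n k * (1 / (x + k)) := by
    rw [← sub_eq_zero, Finset.mul_sum, Finset.mul_sum, Finset.mul_sum, Finset.mul_sum,
      ← Finset.sum_sub_distrib, ← Finset.sum_add_distrib, ← Finset.sum_sub_distrib,
      ← Finset.sum_sub_distrib,
      ← sum_legTerm_telescope hx n (fun _ => 1) (fun k => genH k x ^ 2)
        (fun k => (genH k x - 1 / (x + k)) ^ 2) (fun k => by rw [genH_succ_sub])]
    refine Finset.sum_congr rfl fun k _ => ?_
    have := add_natCast_ne_zero hx k
    field_simp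
    ring
  have t22 : (2 - x) * ∑ k ∈ range (n + 1), legTerm x n k * (k ^ 2 * genH k x ^ 2)
      = (n * (n + 1) - 1) * ∑ k ∈ range (n + 1), legTerm x n k * (k * genH k x ^ 2)
        + n * (n + 1) * ∑ k ∈ range (n + 1), legTerm x n k * genH k x ^ 2
        - 2 * ∑ k ∈ range (n + 1), legTerm x n k * (k ^ 2 * genH k x)
        + ∑ k ∈ range (n + 1), legTerm x n k * k
        - x * ∑ k ∈ range (n + 1), legTerm x n k
        + x ^ 2 * ∑ k ∈ range (n + 1), legTerm x n k * (1 / (x + k)) := by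
    rw [← sub_eq_zero, Finset.mul_sum, Finset.mul_sum, Finset.mul_sum, Finset.mul_sum,
      Finset.mul_sum, Finset.mul_sum, ← Finset.sum_add_distrib,
      ← Finset.sum_sub_distrib, ← Finset.sum_add_distrib, ← Finset.sum_sub_distrib,
      ← Finset.sum_add_distrib, ← Finset.sum_sub_distrib,
      ← sum_legTerm_telescope hx n (fun t => t) (fun k => genH k x ^ 2)
        (fun k => (genH k x - 1 / (x + k)) ^ 2) (fun k => by rw [genH_succ_sub])]
    refine Finset.sum_congr rfl fun k _ => ?_
    have := add_natCast_ne_zero hx k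
    field_simp
    ring
  rw [mul_comm, ← eq_div_iff h1] at t10 t11 t12
  rw [mul_comm, ← eq_div_iff h2] at t20 t21 t22
  rw [t22, t21, t12, t11, t20, t10, sum_legTerm_genH_sq hx, sum_legTerm_genH hx,
    sum_legTerm_div hx, sum_legTerm hx]
  have hx0 : x ≠ 0 := by simpa using hx 0
  field_simp
  ring

theorem Ufun_eq {n : ℕ} {x : ℂ} (hn0 : (n : ℂ) ≠ 0) (hn1 : 1 + (n : ℂ) ≠ 0)
    (hq : (n : ℂ) + (n : ℂ) ^ 2 - x ≠ 0) (hx0 : x ≠ 0) :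
    Ufun n x = 2 / x + 2 * (x * (1 - n * (n + 1) + x - x ^ 2)
      / (n * (n + 1) * (n * (n + 1) - x))) := by
  unfold Ufun
  rw [show (n : ℂ) + (n : ℂ) ^ 2 = n * (1 + n) by ring] at hq ⊢
  rw [add_comm (n : ℂ) 1]
  field_simp
  ring

theorem Vfun_eq {n : ℕ} {x : ℂ} (hn0 : (n : ℂ) ≠ 0) (hn1 : 1 + (n : ℂ) ≠ 0)
    (hq : (n : ℂ) + (n : ℂ) ^ 2 - x ≠ 0) (hx0 : x ≠ 0) (hnx : (n : ℂ) - x ≠ 0) :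
    Vfun n x = 2 * (1 / x + 2 / (n - x)) + 2 * (x * (1 - n * (n + 1) + x - x ^ 2)
      / (n * (n + 1) * (n * (n + 1) - x))) := by
  unfold Vfun
  rw [show (n : ℂ) + (n : ℂ) ^ 2 = n * (1 + n) by ring] at hq ⊢
  rw [add_comm (n : ℂ) 1]
  field_simp
  ring

theorem Wfun_eq {n : ℕ} {x : ℂ} (hn0 : (n : ℂ) ≠ 0) (hn1 : 1 + (n : ℂ) ≠ 0)
    (hq : (n : ℂ) + (n : ℂ) ^ 2 - x ≠ 0) (hx0 : x ≠ 0) (hnx : (n : ℂ) - x ≠ 0) :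
    Wfun n x = (1 / x + 2 / (n - x)) ^ 2 - 1 / x ^ 2
      + 2 * (1 / x + 2 / (n - x)) * (x * (1 - n * (n + 1) + x - x ^ 2)
        / (n * (n + 1) * (n * (n + 1) - x)))
      - 2 * (2 * (n * (n + 1)) - 1 - x + x ^ 2) / (n * (n + 1) * (n * (n + 1) - x)) := by
  unfold Wfun
  rw [show (n : ℂ) + (n : ℂ) ^ 2 = n * (1 + n) by ring] at hq ⊢
  rw [add_comm (n : ℂ) 1]
  field_simp
  ring

theorem stmt5 (n : ℕ) (hn : 2 ≤ n) (x : ℂ) (hx : ∀ m : ℤ, x ≠ (m : ℂ)) :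
    ∑ k ∈ Finset.range (n + 1),
      (-1 : ℂ) ^ k * (n.choose k : ℂ) * (((n + k).choose k : ℂ) / cbinom (x + k) k) *
        (k : ℂ) ^ 2 * (genH k x) ^ 2
    = (-1 : ℂ) ^ n *
      (((n : ℂ) + (n : ℂ) ^ 2) * ((n : ℂ) + (n : ℂ) ^ 2 - x) / (2 * (1 - x) * (2 - x))) *
      (cbinom (-x + n) n / cbinom (x + n) n) *
      (genH2 n x - genH2 n (-x)
        + 2 * (genH n x + genH (n - 2) (2 - x) + 2 / ((n : ℂ) + (n : ℂ) ^ 2 - x)) *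
          (genH n x + genH (n - 2) (2 - x))
        - (genH n x - genH n (-x) - 2 * genH (n + 1) ((x - n - 2) / 2) + Ufun n x) *
          (genH n x - genH n (-x))
        - genH n ((x - n) / 2) * (genH n ((x - n) / 2) - Vfun n x)
        + 2 * (2 * x ^ 2 - 6 * x + 5) / ((1 - x) ^ 2 * (2 - x) ^ 2)
        - Wfun n x) := by
  have hx0 : x ≠ 0 := by simpa using hx 0
  have h1 : 1 - x ≠ 0 := by exact_mod_cast natCast_sub_ne_zero hx 1
  have h2 : 2 - x ≠ 0 := by exact_mod_cast natCast_sub_ne_zero hx 2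
  have hn0 : (n : ℂ) ≠ 0 := by exact_mod_cast (by omega : n ≠ 0)
  have hn1 : 1 + (n : ℂ) ≠ 0 := by exact_mod_cast (by omega : 1 + n ≠ 0)
  have hnx : (n : ℂ) - x ≠ 0 := natCast_sub_ne_zero hx n
  have hnnx : (n : ℂ) + (n : ℂ) ^ 2 - x ≠ 0 := by
    exact_mod_cast natCast_sub_ne_zero hx (n + n ^ 2)
  have hshift : genH (n - 2) (2 - x) = genH n (-x) - 1 / (1 - x) - 1 / (2 - x) := by
    obtain ⟨m, rfl⟩ : ∃ m, n = m + 2 := ⟨n - 2, by omega⟩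
    rw [genH_succ_left, genH_succ_left, Nat.add_sub_cancel, show -x + 1 = 1 - x by ring,
      show 1 - x + 1 = 2 - x by ring]
    ring
  have hhalf : genH (n + 1) ((x - n - 2) / 2) = genH n ((x - n) / 2) - 2 / (n - x) := by
    rw [genH_succ_left, show (x - n - 2) / 2 + 1 = -((n - x) / 2) by ring,
      show -(((n : ℂ) - x) / 2) = (x - n) / 2 by ring, show x - n = -((n : ℂ) - x) by ring]
    field_simp
    ring
  rw [Finset.sum_congr rfl fun k _ => show _ = legTerm x n k * (k ^ 2 * genH k x ^ 2) by
    rw [legTerm]; ring,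
    sum_legTerm_sq_mul_genH_sq hx, hhalf, genH_half_eq hx, hshift, mul_right_comm ((-1 : ℂ) ^ n),
    show (-1 : ℂ) ^ n * (cbinom (-x + n) n / cbinom (x + n) n) = legSum x n from rfl]
  rw [Ufun_eq hn0 hn1 hnnx hx0, Vfun_eq hn0 hn1 hnnx hx0 hnx, Wfun_eq hn0 hn1 hnnx hx0 hnx]
  generalize genH n x = a
  generalize genH n (-x) = b
  generalize genH2 n x - genH2 n (-x) = c
  generalize altSum x n = s
  generalize 2 / ((n : ℂ) - x) = r
  rw [show (n : ℂ) + (n : ℂ) ^ 2 = n * (n + 1) by ring] at hnnx ⊢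
  have hnu : (n : ℂ) * (n + 1) ≠ 0 := mul_ne_zero hn0 (by rwa [add_comm])
  generalize (n : ℂ) * (n + 1) = ν at hnnx hnu ⊢
  field_simp
  ring
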